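/- Double selector failure, upper bound on the probability that a single-SP-supported row is a complete-SP row: let μ be the product Bernoulli(q) measure on Fin N → Fin N → Bool with N ≥ 2, 0 < q < 1. Fix φ = {(i,j),(i',j')} with i ≠ i', j ≠ j', and m ∉ {i,i'}. Then the conditional probability, given the event {X i j = true ∧ X i' j' = true ∧ X m j = true ∧ X m j' = false} (both SFs active, row m single-SP-supported), that row m is a complete-SP row is at most (1 − q(1−q)²)^{N−2}. -/

import Mathlib

open MeasureTheory

/-- Bernoulli(q) measure on `Bool`: `true` has probability `q`. -/
noncomputable def bern (q : ℝ) : Measure Bool :=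
  (ENNReal.ofReal q) • Measure.dirac true + (ENNReal.ofReal (1 - q)) • Measure.dirac false

instance (q : ℝ) : IsFiniteMeasure (bern q) := by
  constructor
  simp [bern, Measure.add_apply, Measure.smul_apply]

/-- Product measure on `Fin N → Fin N → Bool` making the `N²` entries i.i.d. Bernoulli(q). -/
noncomputable def arrMeasure (N : ℕ) (q : ℝ) : Measure (Fin N → Fin N → Bool) :=
  Measure.pi fun _ => Measure.pi fun _ => bern q

/-- Cell `(m,n)` is an SP cell for the double-SF set `{(i,j),(i',j')}` (both active). -/
def IsSPCellDouble (N : ℕ) (X : Fin N → Fin N → Bool)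
    (i i' j j' m n : Fin N) : Prop :=
  X m n = false ∧
    ((X i n = true ∧ X m j = true) ∨ (X i' n = true ∧ X m j' = true))

/-- Row `m` is a complete-SP row: it contains an SP cell, and every critical cell
`(m,n)` with `n ∉ {j,j'}` (row `m` SP-supported and column `n` SP-supported) is
either LRS (`true`) or an SP cell. -/
def IsCompleteSPRow (N : ℕ) (X : Fin N → Fin N → Bool)
    (i i' j j' m : Fin N) : Prop :=
  (∃ n : Fin N, IsSPCellDouble N X i i' j j' m n) ∧
  ∀ n : Fin N, n ≠ j → n ≠ j' → (X m j = true ∨ X m j' = true) →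
    (X i n = true ∨ X i' n = true) →
    X m n = true ∨ IsSPCellDouble N X i i' j j' m n

theorem bern_prob (q : ℝ) (hq0 : 0 < q) (hq1 : q < 1) : IsProbabilityMeasure (bern q) := by
  constructor
  simp only [bern, Measure.add_apply, Measure.smul_apply, measure_univ, smul_eq_mul, mul_one]
  rw [← ENNReal.ofReal_add hq0.le (by linarith)]
  simp

theorem arr_swap (N : ℕ) (q : ℝ) :
    (arrMeasure N q).map (fun X n m => X m n) = arrMeasure N q := by
  apply Measure.ext_of_singleton
  intro Y
  rw [Measure.map_apply (measurable_of_finite _) (measurableSet_singleton _)]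
  have h1 : (fun (X : Fin N → Fin N → Bool) n m => X m n) ⁻¹' {Y} = {fun m n => Y n m} := by
    ext X
    simp only [Set.mem_preimage, Set.mem_singleton_iff, funext_iff]
    exact ⟨fun h a b => h b a, fun h a b => h b a⟩
  rw [h1]
  simp only [arrMeasure, Measure.pi_singleton]
  exact Finset.prod_comm

theorem arr_cols (N : ℕ) (q : ℝ) (S : Fin N → Set (Fin N → Bool)) :
    arrMeasure N q {X | ∀ n, (fun m => X m n) ∈ S n} =
      ∏ n, (Measure.pi fun _ : Fin N => bern q) (S n) := by
  have h := Measure.pi_pi (fun _ : Fin N => (Measure.pi fun _ : Fin N => bern q)) S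
  rw [← h]
  change _ = arrMeasure N q _
  conv_rhs => rw [← arr_swap]
  rw [Measure.map_apply (measurable_of_finite _) (Set.toFinite _).measurableSet]
  congr 1
  ext X
  simp [Set.mem_pi]

theorem col_bad (N : ℕ) (q : ℝ) (hq0 : 0 < q) (hq1 : q < 1) (i i' m : Fin N)
    (hii : i ≠ i') (hmi : m ≠ i) (hmi' : m ≠ i') :
    (Measure.pi fun _ : Fin N => bern q)
      {x | ¬ (x i = false ∧ x i' = true ∧ x m = false)} =
      ENNReal.ofReal (1 - q * (1 - q) ^ 2) := by
  have := bern_prob q hq0 hq1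
  have ht : bern q {true} = ENNReal.ofReal q := by simp [bern]
  have hf : bern q {false} = ENNReal.ofReal (1 - q) := by simp [bern]
  have hb : (Measure.pi fun _ : Fin N => bern q) {x | x i = false ∧ x i' = true ∧ x m = false}
      = ENNReal.ofReal (q * (1 - q) ^ 2) := by
    have he : {x : Fin N → Bool | x i = false ∧ x i' = true ∧ x m = false} =
        Set.pi Set.univ (fun k => if k = i then {false} else if k = i' then {true}
          else if k = m then {false} else Set.univ) := by
      ext x
      simp only [Set.mem_setOf_eq, Set.mem_pi, Set.mem_univ, true_implies]
      constructor
      · rintro ⟨h1, h2, h3⟩ k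
        split_ifs <;> simp_all
      · intro h
        have a := h i
        have b := h i'
        have c := h m
        simp_all [hii.symm]
    rw [he, Measure.pi_pi]
    have hk : ∀ k, bern q (if k = i then {false} else if k = i' then {true}
          else if k = m then {false} else Set.univ) =
        (if k = i then ENNReal.ofReal (1 - q) else 1) * ((if k = i' then ENNReal.ofReal q else 1)
          * (if k = m then ENNReal.ofReal (1 - q) else 1)) := by
      intro k
      have hu : bern q Set.univ = 1 := measure_univ
      clear he
      split_ifs <;> simp_all [-Bool.univ_eq, -Set.univ_eq_true_false]
    simp only [hk, Finset.prod_mul_distrib, Finset.prod_ite_eq', Finset.mem_univ, if_true]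
    rw [← ENNReal.ofReal_mul hq0.le, ← ENNReal.ofReal_mul (by linarith)]
    congr 1
    ring
  change (Measure.pi fun _ : Fin N => bern q) {x : Fin N → Bool | x i = false ∧ x i' = true ∧ x m = false}ᶜ = _
  rw [prob_compl_eq_one_sub (Set.toFinite _).measurableSet, hb,
    ENNReal.ofReal_sub _ (by have : 0 < 1 - q := by linarith
                             positivity), ENNReal.ofReal_one]

/-- Double selector failure: conditioned on both SFs being active and
row `m ∉ {i,i'}` being single-SP-supported (`X m j = true`, `X m j' = false`), row `m`
is a complete-SP row with probability at most `(1 − q(1−q)²)^{N−2}`. -/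
theorem double_sf_single_supported_row_complete_sp_prob_le
    (N : ℕ) (hN : 2 ≤ N) (q : ℝ) (hq0 : 0 < q) (hq1 : q < 1)
    (i i' j j' m : Fin N)
    (hii : i ≠ i') (hjj : j ≠ j') (hmi : m ≠ i) (hmi' : m ≠ i') :
    (arrMeasure N q) ({X : Fin N → Fin N → Bool | IsCompleteSPRow N X i i' j j' m} ∩
      {X : Fin N → Fin N → Bool |
        X i j = true ∧ X i' j' = true ∧ X m j = true ∧ X m j' = false})
      / (arrMeasure N q) {X : Fin N → Fin N → Bool |
        X i j = true ∧ X i' j' = true ∧ X m j = true ∧ X m j' = false}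
    ≤ ENNReal.ofReal ((1 - q * (1 - q) ^ 2) ^ (N - 2)) := by
  have := bern_prob q hq0 hq1
  apply ENNReal.div_le_of_le_mul
  let T : Fin N → Set (Fin N → Bool) := fun n => {x | (n = j → x i = true ∧ x m = true) ∧
    (n = j' → x i' = true ∧ x m = false)}
  let S : Fin N → Set (Fin N → Bool) := fun n => if n = j ∨ n = j' then T n else
    {x | ¬ (x i = false ∧ x i' = true ∧ x m = false)}
  have hT : {X : Fin N → Fin N → Bool |
        X i j = true ∧ X i' j' = true ∧ X m j = true ∧ X m j' = false} =
      {X | ∀ n, (fun m => X m n) ∈ T n} := by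
    ext X
    simp only [T, Set.mem_setOf_eq]
    constructor
    · rintro ⟨h1, h2, h3, h4⟩ n
      exact ⟨by rintro rfl; exact ⟨h1, h3⟩, by rintro rfl; exact ⟨h2, h4⟩⟩
    · intro h
      have a := (h j).1 rfl
      have b := (h j').2 rfl
      exact ⟨a.1, b.1, a.2, b.2⟩
  have hS : ({X : Fin N → Fin N → Bool | IsCompleteSPRow N X i i' j j' m} ∩
      {X : Fin N → Fin N → Bool |
        X i j = true ∧ X i' j' = true ∧ X m j = true ∧ X m j' = false}) ⊆
      {X | ∀ n, (fun m => X m n) ∈ S n} := by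
    rintro X ⟨h1, h2⟩ n
    have h3 := h2
    rw [hT] at h2
    by_cases hn : n = j ∨ n = j'
    · simp only [S, if_pos hn]
      exact h2 n
    · simp only [S, if_neg hn, Set.mem_setOf_eq]
      rintro ⟨a, b, c⟩
      obtain ⟨-, -, h5, h6⟩ := h3
      push Not at hn
      have := h1.2 n hn.1 hn.2 (Or.inl h5) (Or.inr b)
      simp [IsSPCellDouble, a, c, h6] at this
  refine (measure_mono hS).trans ?_
  rw [hT, arr_cols, arr_cols]
  have hk : ∀ n, (Measure.pi fun _ : Fin N => bern q) (S n) =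
      (if n = j ∨ n = j' then 1 else ENNReal.ofReal (1 - q * (1 - q) ^ 2)) *
        (Measure.pi fun _ : Fin N => bern q) (T n) := by
    intro n
    by_cases hn : n = j ∨ n = j'
    · simp only [S, if_pos hn, one_mul]
    · have hu : T n = Set.univ := by
        push Not at hn
        ext x
        simp [T, hn.1, hn.2]
      simp only [S, if_neg hn, hu, measure_univ, mul_one]
      exact col_bad N q hq0 hq1 i i' m hii hmi hmi'
  simp only [hk, Finset.prod_mul_distrib]
  apply le_of_eq
  congr 1
  have hp : 0 ≤ 1 - q * (1 - q) ^ 2 := by nlinarith [mul_pos hq0 (sub_pos.2 hq1)]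
  rw [Finset.prod_ite, Finset.prod_const_one, one_mul, Finset.prod_const, ENNReal.ofReal_pow hp]
  congr 1
  have hc : (Finset.univ.filter fun n => ¬ (n = j ∨ n = j')) = ({j, j'} : Finset (Fin N))ᶜ := by
    ext n; simp
  rw [hc, Finset.card_compl, Finset.card_pair hjj, Fintype.card_fin]
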